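/- arXiv:2510.03860 — 4 statements merged into one kernel-verified Lean document; each statement's English description precedes it below -/
import Mathlib

section
/- (Proposition 1, convexity of the per-round problem.) Let α ≥ 2 be an integer, M ≥ 1, and for each m ∈ {1,…,M} let q_m ∈ [0,1] and a_m > 0. Let V ≥ 0, Q ≥ 0, c ≥ 0, and x_max > 0. Then the function F(x) = V · Σ_{m=1}^{M} ρ_α(q_m, a_m/√x) + Q·c·(1/x − 1/x_max) + (1/2)·c²·(1/x − 1/x_max)² is convex on the interval (0, x_max]. -/
/-- The RDP leakage function `ρ_α(q, σ)` of the sampled Gaussian mechanism. -/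
noncomputable def rdpLeak (α : ℕ) (q σ : ℝ) : ℝ :=
  ((α : ℝ) - 1)⁻¹ *
    Real.log (∑ k ∈ Finset.range (α + 1),
      (α.choose k : ℝ) * (1 - q) ^ (α - k) * q ^ k *
        Real.exp (((k : ℝ) ^ 2 - (k : ℝ)) / (2 * σ ^ 2)))

/-- A log-sum-exp of linear functions, with nonnegative weights, is convex. -/
theorem convexOn_log_sum_mul_exp {ι : Type*} (s : Finset ι) (w b : ι → ℝ)
    (hw : ∀ i ∈ s, 0 ≤ w i) (hpos : 0 < ∑ i ∈ s, w i) :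
    ConvexOn ℝ Set.univ (fun x : ℝ => Real.log (∑ i ∈ s, w i * Real.exp (b i * x))) := by
  have hsum : ∀ x : ℝ, 0 < ∑ i ∈ s, w i * Real.exp (b i * x) := by
    intro x
    obtain ⟨i, hi, hwi⟩ := (Finset.sum_pos_iff_of_nonneg hw).1 hpos
    exact Finset.sum_pos' (fun j hj => mul_nonneg (hw j hj) (Real.exp_pos _).le)
      ⟨i, hi, mul_pos hwi (Real.exp_pos _)⟩
  refine ⟨convex_univ, fun x _ y _ t u ht hu htu => ?_⟩
  simp only [smul_eq_mul]
  set A := ∑ i ∈ s, w i * Real.exp (b i * x) with hA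
  set B := ∑ i ∈ s, w i * Real.exp (b i * y) with hB
  have hA0 : 0 < A := hsum x
  have hB0 : 0 < B := hsum y
  rw [Real.log_le_iff_le_exp (hsum _)]
  have key : ∀ i ∈ s, w i * Real.exp (b i * (t * x + u * y)) ≤
      Real.exp (t * Real.log A + u * Real.log B) *
        (t / A * (w i * Real.exp (b i * x)) + u / B * (w i * Real.exp (b i * y))) := by
    intro i hi
    have h := convexOn_exp.2 (Set.mem_univ (b i * x - Real.log A))
      (Set.mem_univ (b i * y - Real.log B)) ht hu htu
    simp only [smul_eq_mul, Real.exp_sub, Real.exp_log hA0, Real.exp_log hB0] at h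
    have e : b i * (t * x + u * y) = (t * Real.log A + u * Real.log B) +
        (t * (b i * x - Real.log A) + u * (b i * y - Real.log B)) := by ring
    rw [e, Real.exp_add]
    calc _ ≤ w i * (Real.exp (t * Real.log A + u * Real.log B) *
          (t * (Real.exp (b i * x) / A) + u * (Real.exp (b i * y) / B))) := by
            have := hw i hi
            gcongr
      _ = _ := by ring
  refine (Finset.sum_le_sum key).trans_eq ?_
  rw [← Finset.mul_sum, Finset.sum_add_distrib, ← Finset.mul_sum, ← Finset.mul_sum, ← hA, ← hB,
    div_mul_cancel₀ _ hA0.ne', div_mul_cancel₀ _ hB0.ne', htu, mul_one]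

theorem convexOn_rdpLeak_div_sqrt {α : ℕ} (hα : 1 ≤ α) {q : ℝ} (hq : q ∈ Set.Icc (0 : ℝ) 1)
    (a : ℝ) : ConvexOn ℝ (Set.Ioi (0 : ℝ)) (fun x => rdpLeak α q (a / Real.sqrt x)) := by
  have hconv := convexOn_log_sum_mul_exp (Finset.range (α + 1))
    (fun k => (α.choose k : ℝ) * (1 - q) ^ (α - k) * q ^ k)
    (fun k => ((k : ℝ) ^ 2 - k) / (2 * a ^ 2))
    (fun k _ => mul_nonneg (mul_nonneg (Nat.cast_nonneg _)
      (pow_nonneg (sub_nonneg.2 hq.2) _)) (pow_nonneg hq.1 _))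
    (by
      have h := add_pow q (1 - q) α
      rw [add_sub_cancel, one_pow] at h
      refine one_pos.trans_eq (h.trans (Finset.sum_congr rfl fun k _ => ?_))
      ring)
  have hα' : (0 : ℝ) ≤ ((α : ℝ) - 1)⁻¹ := inv_nonneg.2 (sub_nonneg.2 (by exact_mod_cast hα))
  refine ((hconv.subset (Set.subset_univ _) (convex_Ioi 0)).smul hα').congr fun x hx => ?_
  simp only [rdpLeak, smul_eq_mul]
  congr 2
  refine Finset.sum_congr rfl fun k _ => ?_
  rw [div_pow, Real.sq_sqrt (le_of_lt hx), mul_div_assoc', div_div_eq_mul_div, div_mul_eq_mul_div]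

/-- Proposition 1, convexity of the per-round problem: for an integer `α ≥ 2`,
`M ≥ 1` devices with `q_m ∈ [0,1]` and `a_m > 0`, `V ≥ 0`, `Q ≥ 0`, `c ≥ 0`, `x_max > 0`, the
function `F(x) = V·Σ_m ρ_α(q_m, a_m/√x) + Q·c·(1/x − 1/x_max) + (1/2)·c²·(1/x − 1/x_max)²`
is convex on `(0, x_max]`. -/
theorem stmt2 (α : ℕ) (hα : 2 ≤ α) (M : ℕ) (hM : 1 ≤ M)
    (q a : Fin M → ℝ) (hq : ∀ m, q m ∈ Set.Icc (0 : ℝ) 1) (ha : ∀ m, 0 < a m)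
    (V Q c : ℝ) (hV : 0 ≤ V) (hQ : 0 ≤ Q) (hc : 0 ≤ c)
    (xmax : ℝ) (hxmax : 0 < xmax) :
    ConvexOn ℝ (Set.Ioc (0 : ℝ) xmax)
      (fun x : ℝ =>
        V * ∑ m, rdpLeak α (q m) (a m / Real.sqrt x)
          + Q * c * (1 / x - 1 / xmax)
          + (1 / 2) * c ^ 2 * (1 / x - 1 / xmax) ^ 2) := by
  have hsub : Set.Ioc (0 : ℝ) xmax ⊆ Set.Ioi 0 := fun x hx => hx.1
  have hS : Convex ℝ (Set.Ioc (0 : ℝ) xmax) := convex_Ioc 0 xmax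
  have hleak : ConvexOn ℝ (Set.Ioc (0 : ℝ) xmax)
      (fun x => ∑ m, rdpLeak α (q m) (a m / Real.sqrt x)) := by
    have h : ∀ s : Finset (Fin M), ConvexOn ℝ (Set.Ioc (0 : ℝ) xmax)
        (fun x => ∑ m ∈ s, rdpLeak α (q m) (a m / Real.sqrt x)) := by
      intro s
      induction s using Finset.cons_induction with
      | empty => simpa using convexOn_const 0 hS
      | cons m s hm ih =>
        simp only [Finset.sum_cons]
        exact ((convexOn_rdpLeak_div_sqrt (by omega) (hq m) (a m)).subset hsub hS).add ih
    exact h Finset.univ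
  have hinv : ConvexOn ℝ (Set.Ioc (0 : ℝ) xmax) (fun x => 1 / x - 1 / xmax) := by
    have h := ((convexOn_zpow (-1)).subset hsub hS).add_const (-(1 / xmax))
    refine h.congr fun x _ => ?_
    simp [sub_eq_add_neg]
  have hnonneg : ∀ ⦃x⦄, x ∈ Set.Ioc (0 : ℝ) xmax → 0 ≤ 1 / x - 1 / xmax :=
    fun x hx => sub_nonneg.2 (one_div_le_one_div_of_le hx.1 hx.2)
  exact ((hleak.smul hV).add (hinv.smul (mul_nonneg hQ hc))).add
    ((hinv.pow hnonneg 2).smul (show 0 ≤ (1 / 2) * c ^ 2 by positivity))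
end

section
/- (Lemma 2, virtual queue upper bound.) Let T be a positive integer, ν ≥ 0, V > 0, and let g, p, m : ℕ → ℝ satisfy, for all t < T: g_t ≥ 0, p_t ≥ 0, m_t ≥ 0, and V·p_t + Q_t·g_t + (1/2)·g_t² ≤ V·m_t, where Q_0 = 0 and Q_{t+1} = max(Q_t + g_t − ν, 0). Then for every R with 0 ≤ R ≤ T, Q_R ≤ √( 2V·Σ_{t=0}^{T−1} m_t + T·ν² ). -/
theorem sq_max_add_sub_le {q g ν : ℝ} (hq : 0 ≤ q) (hg : 0 ≤ g) (hν : 0 ≤ ν) :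
    max (q + g - ν) 0 ^ 2 ≤ q ^ 2 + 2 * (q * g + (1 / 2) * g ^ 2) + ν ^ 2 := by
  have hcross : 0 ≤ ν * (q + g) := by positivity
  rcases max_cases (q + g - ν) 0 with ⟨h, -⟩ | ⟨h, -⟩ <;> rw [h]
  · nlinarith
  · rw [zero_pow two_ne_zero]; positivity

/-- Lemma 2, virtual queue upper bound: with queue `Q_0 = 0`,
`Q_{t+1} = max(Q_t + g_t − ν, 0)`, if for all `t < T` we have `g_t, p_t, m_t ≥ 0` and
`V·p_t + Q_t·g_t + (1/2)g_t² ≤ V·m_t`, then for every `R ≤ T`,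
`Q_R ≤ √(2V·Σ_{t<T} m_t + T·ν²)`. -/
theorem stmt5 (T : ℕ) (hT : 0 < T) (ν V : ℝ) (hν : 0 ≤ ν) (hV : 0 < V)
    (g p m : ℕ → ℝ)
    (Q : ℕ → ℝ) (hQ0 : Q 0 = 0) (hQ : ∀ t, Q (t + 1) = max (Q t + g t - ν) 0)
    (hg : ∀ t < T, 0 ≤ g t) (hp : ∀ t < T, 0 ≤ p t) (hm : ∀ t < T, 0 ≤ m t)
    (hopt : ∀ t < T, V * p t + Q t * g t + (1 / 2) * (g t) ^ 2 ≤ V * m t) :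
    ∀ R ≤ T, Q R ≤ Real.sqrt (2 * V * (∑ t ∈ Finset.range T, m t) + T * ν ^ 2) := by
  have hQ_nonneg : ∀ t, 0 ≤ Q t
    | 0 => hQ0.ge
    | t + 1 => hQ t ▸ le_max_right _ _
  have hQ_sq : ∀ R ≤ T, Q R ^ 2 ≤ 2 * V * (∑ t ∈ Finset.range R, m t) + R * ν ^ 2 := by
    intro R
    induction R with
    | zero => simp [hQ0]
    | succ t ih =>
      intro ht
      have hdrift := sq_max_add_sub_le (hQ_nonneg t) (hg t ht) hν
      have hVp := mul_nonneg hV.le (hp t ht)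
      rw [hQ, Finset.sum_range_succ]
      push_cast
      linarith [ih (Nat.le_of_succ_le ht), hopt t ht]
  intro R hR
  refine Real.le_sqrt_of_sq_le ((hQ_sq R hR).trans ?_)
  gcongr 2 * V * ?_ + ?_ * ν ^ 2
  · exact Finset.sum_le_sum_of_subset_of_nonneg (Finset.range_mono hR)
      fun t ht _ => hm t (Finset.mem_range.mp ht)
  · exact_mod_cast hR
end

section
/- (Theorem 2, constraint violation bound.) Let T be a positive integer, ν ≥ 0, V > 0, and let g, p, m : ℕ → ℝ satisfy, for all t < T: g_t ≥ 0, p_t ≥ 0, m_t ≥ 0, and V·p_t + Q_t·g_t + (1/2)·g_t² ≤ V·m_t, where Q_0 = 0 and Q_{t+1} = max(Q_t + g_t − ν, 0). Then (1/T)·Σ_{t=0}^{T−1} g_t − ν ≤ √( 2V·Σ_{t=0}^{T−1} m_t + T·ν² ) / T. -/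
/-- Theorem 2, constraint violation bound: with queue `Q_0 = 0`,
`Q_{t+1} = max(Q_t + g_t − ν, 0)`, if for all `t < T` we have `g_t, p_t, m_t ≥ 0` and
`V·p_t + Q_t·g_t + (1/2)g_t² ≤ V·m_t`, then
`(1/T)·Σ_{t<T} g_t − ν ≤ √(2V·Σ_{t<T} m_t + T·ν²)/T`. -/
theorem stmt7 (T : ℕ) (hT : 0 < T) (ν V : ℝ) (hν : 0 ≤ ν) (hV : 0 < V)
    (g p m : ℕ → ℝ)
    (Q : ℕ → ℝ) (hQ0 : Q 0 = 0) (hQ : ∀ t, Q (t + 1) = max (Q t + g t - ν) 0)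
    (hg : ∀ t < T, 0 ≤ g t) (hp : ∀ t < T, 0 ≤ p t) (hm : ∀ t < T, 0 ≤ m t)
    (hopt : ∀ t < T, V * p t + Q t * g t + (1 / 2) * (g t) ^ 2 ≤ V * m t) :
    (1 / T) * (∑ t ∈ Finset.range T, g t) - ν
      ≤ Real.sqrt (2 * V * (∑ t ∈ Finset.range T, m t) + T * ν ^ 2) / T := by
  have key : ∀ n ≤ T, 0 ≤ Q n ∧ (∑ t ∈ Finset.range n, g t) - n * ν ≤ Q n ∧
      (Q n) ^ 2 ≤ 2 * V * (∑ t ∈ Finset.range n, m t) + n * ν ^ 2 := by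
    intro n
    induction n with
    | zero => intro _; simp [hQ0]
    | succ n ih =>
      intro hn
      obtain ⟨h0, hsum, hsq⟩ := ih (by omega)
      have hgn := hg n hn
      have hVp := mul_nonneg hV.le (hp n hn)
      have ho := hopt n hn
      have hle := le_max_left (Q n + g n - ν) 0
      have hdrift : (max (Q n + g n - ν) 0) ^ 2 ≤ (Q n + g n - ν) ^ 2 := by
        rcases max_choice (Q n + g n - ν) 0 with h | h <;> rw [h]
        simpa using sq_nonneg (Q n + g n - ν)
      rw [Finset.sum_range_succ, Finset.sum_range_succ, hQ n]
      push_cast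
      refine ⟨le_max_right _ _, by linarith, ?_⟩
      linarith [mul_nonneg h0 hν, mul_nonneg hgn hν]
  obtain ⟨-, hsum, hsq⟩ := key T le_rfl
  have hT' : (0 : ℝ) < T := by exact_mod_cast hT
  have hrw : (1 / T) * (∑ t ∈ Finset.range T, g t) - ν
      = ((∑ t ∈ Finset.range T, g t) - T * ν) / T := by
    field_simp
  rw [hrw]
  gcongr
  exact hsum.trans (Real.le_sqrt_of_sq_le hsq)
end

section
/- (Theorem 3, dynamic regret bound.) Let T be a positive integer, ν ≥ 0, V > 0, Q_max ∈ ℝ, and let g, g*, p, p* : ℕ → ℝ. Define Q : ℕ → ℝ by Q_0 = 0 and Q_{t+1} = max(Q_t + g_t − ν, 0). Assume for all t < T: g_t ≥ 0, g*_t ≥ 0, Q_t ≤ Q_max, and the per-round optimality inequality V·p_t + Q_t·g_t + (1/2)·g_t² ≤ V·p*_t + Q_t·g*_t + (1/2)·(g*_t)². Assume further the offline feasibility Σ_{t=0}^{T−1} g*_t ≤ T·ν. Then (1/T)·Σ_{t=0}^{T−1} (p_t − p*_t) ≤ Q_max·ν/V + T·ν²/(2V) + ν²/(2V). -/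
/-- Theorem 3, dynamic regret bound: with queue `Q_0 = 0`,
`Q_{t+1} = max(Q_t + g_t − ν, 0)`, if for all `t < T` we have `g_t ≥ 0`, `g*_t ≥ 0`,
`Q_t ≤ Q_max` and `V·p_t + Q_t·g_t + (1/2)g_t² ≤ V·p*_t + Q_t·g*_t + (1/2)(g*_t)²`,
and the offline solution is feasible, `Σ_{t<T} g*_t ≤ T·ν`, then
`(1/T)·Σ_{t<T} (p_t − p*_t) ≤ Q_max·ν/V + T·ν²/(2V) + ν²/(2V)`. -/
theorem stmt8 (T : ℕ) (hT : 0 < T) (ν V Qmax : ℝ) (hν : 0 ≤ ν) (hV : 0 < V)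
    (g gstar p pstar : ℕ → ℝ)
    (Q : ℕ → ℝ) (hQ0 : Q 0 = 0) (hQ : ∀ t, Q (t + 1) = max (Q t + g t - ν) 0)
    (hg : ∀ t < T, 0 ≤ g t) (hgstar : ∀ t < T, 0 ≤ gstar t)
    (hQmax : ∀ t < T, Q t ≤ Qmax)
    (hopt : ∀ t < T,
      V * p t + Q t * g t + (1 / 2) * (g t) ^ 2
        ≤ V * pstar t + Q t * gstar t + (1 / 2) * (gstar t) ^ 2)
    (hfeas : ∑ t ∈ Finset.range T, gstar t ≤ T * ν) :
    (1 / T) * (∑ t ∈ Finset.range T, (p t - pstar t))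
      ≤ Qmax * ν / V + T * ν ^ 2 / (2 * V) + ν ^ 2 / (2 * V) := by
  have hQ_nonneg : ∀ t, 0 ≤ Q t
    | 0 => hQ0.ge
    | t + 1 => by rw [hQ]; exact le_max_right _ _
  have hQmax_nonneg : 0 ≤ Qmax := hQ0 ▸ hQmax 0 hT
  have hT' : (0 : ℝ) < T := by exact_mod_cast hT
  have hgstar' : ∀ t ∈ Finset.range T, 0 ≤ gstar t := fun t ht =>
    hgstar t (Finset.mem_range.1 ht)
  have hsq : ∑ t ∈ Finset.range T, gstar t ^ 2 ≤ (T * ν) ^ 2 :=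
    (Finset.sum_sq_le_sq_sum_of_nonneg hgstar').trans
      (pow_le_pow_left₀ (Finset.sum_nonneg hgstar') hfeas 2)
  have hround : ∀ t ∈ Finset.range T,
      V * (p t - pstar t) ≤ Qmax * gstar t + 1 / 2 * gstar t ^ 2 := by
    intro t ht
    have htT := Finset.mem_range.1 ht
    have hqg := mul_nonneg (hQ_nonneg t) (hg t htT)
    have hqgstar := mul_le_mul_of_nonneg_right (hQmax t htT) (hgstar t htT)
    linarith [hopt t htT, sq_nonneg (g t)]
  have hsum := Finset.sum_le_sum hround
  rw [← Finset.mul_sum, Finset.sum_add_distrib, ← Finset.mul_sum, ← Finset.mul_sum] at hsum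
  have htotal : V * ∑ t ∈ Finset.range T, (p t - pstar t)
      ≤ Qmax * (T * ν) + 1 / 2 * (T * ν) ^ 2 := by
    linarith [mul_le_mul_of_nonneg_left hfeas hQmax_nonneg]
  calc (1 / T) * (∑ t ∈ Finset.range T, (p t - pstar t))
      = (V * ∑ t ∈ Finset.range T, (p t - pstar t)) / (T * V) := by field_simp
    _ ≤ (Qmax * (T * ν) + 1 / 2 * (T * ν) ^ 2) / (T * V) := by gcongr
    _ = Qmax * ν / V + T * ν ^ 2 / (2 * V) := by field_simp
    _ ≤ Qmax * ν / V + T * ν ^ 2 / (2 * V) + ν ^ 2 / (2 * V) :=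
      le_add_of_nonneg_right (by positivity)
end
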